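/- Let π : T → U be a covering functor between idempotent-complete triangulated categories such that the image of π generates U (i.e., the smallest thick subcategory of U containing all objects πX, X ∈ T, is U itself), and let B be a presilting full subcategory of U that is closed under direct summands and contained in the image of π. Then B generates U if and only if π⁻¹B generates T. -/

import Mathlib

open CategoryTheory CategoryTheory.Limits CategoryTheory.Pretriangulated
open ZeroObject DirectSum

section Defs

variable (C : Type*) [Category C] [Preadditive C] [HasZeroObject C]
  [HasShift C ℤ] [∀ n : ℤ, (shiftFunctor C n).Additive] [Pretriangulated C]

/-- A set of objects `P` of a (pre)triangulated category is *thick* if it is the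
class of objects of a full triangulated subcategory closed under direct summands:
it is closed under isomorphisms, contains `0`, is closed under shifts, under
extensions (in distinguished triangles), and under direct summands (retracts). -/
def IsThickSet (P : Set C) : Prop :=
  (∀ ⦃X Y : C⦄, (X ≅ Y) → X ∈ P → Y ∈ P) ∧
  ((0 : C) ∈ P) ∧
  (∀ (X : C) (n : ℤ), X ∈ P → (X⟦n⟧ : C) ∈ P) ∧
  (∀ T : Triangle C, (T ∈ distTriang C) → T.obj₁ ∈ P → T.obj₃ ∈ P → T.obj₂ ∈ P) ∧
  (∀ X Y : C, (∃ (i : X ⟶ Y) (r : Y ⟶ X), i ≫ r = 𝟙 X) → Y ∈ P → X ∈ P)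

/-- A set of objects `S` *generates* the triangulated category `C` if the smallest
thick subcategory of `C` containing `S` is all of `C`. -/
def GeneratesTriang (S : Set C) : Prop :=
  ∀ P : Set C, IsThickSet C P → S ⊆ P → ∀ X : C, X ∈ P

/-- A (full) subcategory `B` is *presilting* if `Hom(B, B′[i]) = 0` for all
`B, B′ ∈ B` and all integers `i > 0`. -/
def IsPresiltingSet (B : Set C) : Prop :=
  ∀ X ∈ B, ∀ Y ∈ B, ∀ i : ℤ, 0 < i → ∀ f : X ⟶ (Y⟦i⟧), f = 0

/-- A (full) subcategory `B` is *pretilting* if `Hom(B, B′[i]) = 0` for all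
`B, B′ ∈ B` and all integers `i ≠ 0`. -/
def IsPretiltingSet (B : Set C) : Prop :=
  ∀ X ∈ B, ∀ Y ∈ B, ∀ i : ℤ, i ≠ 0 → ∀ f : X ⟶ (Y⟦i⟧), f = 0

/-- `B` is silting if it is presilting and generates. -/
def IsSiltingSet (B : Set C) : Prop :=
  IsPresiltingSet C B ∧ GeneratesTriang C B

/-- `B` is tilting if it is pretilting and generates. -/
def IsTiltingSet (B : Set C) : Prop :=
  IsPretiltingSet C B ∧ GeneratesTriang C B

end Defs

section Covering

variable {T : Type*} [Category T] [Preadditive T]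
  {U : Type*} [Category U] [Preadditive U]

/-- The canonical map `⊕_{Y′ : πY′ = πY} Hom_T(X, Y′) → Hom_U(πX, πY)` whose
components are given by applying `π` (and identifying `πY′` with `πY`). -/
noncomputable def coveringMapRight (F : T ⥤ U) [F.Additive] (X Y : T) :
    (⨁ (Y' : {Y' : T // F.obj Y' = F.obj Y}), (X ⟶ (Y' : T))) →+
      (F.obj X ⟶ F.obj Y) := by
  classical
  exact DirectSum.toAddMonoid fun Y' =>
    { toFun := fun f => F.map f ≫ eqToHom Y'.2
      map_zero' := by simp
      map_add' := fun f g => by rw [F.map_add, Preadditive.add_comp] }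

/-- The canonical map `⊕_{X′ : πX′ = πX} Hom_T(X′, Y) → Hom_U(πX, πY)` whose
components are given by applying `π` (and identifying `πX′` with `πX`). -/
noncomputable def coveringMapLeft (F : T ⥤ U) [F.Additive] (X Y : T) :
    (⨁ (X' : {X' : T // F.obj X' = F.obj X}), ((X' : T) ⟶ Y)) →+
      (F.obj X ⟶ F.obj Y) := by
  classical
  exact DirectSum.toAddMonoid fun X' =>
    { toFun := fun f => eqToHom X'.2.symm ≫ F.map f
      map_zero' := by simp
      map_add' := fun f g => by rw [F.map_add, Preadditive.comp_add] }

/-- An additive functor `π : T → U` is a *covering functor* if for all objects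
`X, Y` of `T` the two canonical maps
`⊕_{Y′ : πY′=πY} Hom_T(X,Y′) → Hom_U(πX,πY)` and
`⊕_{X′ : πX′=πX} Hom_T(X′,Y) → Hom_U(πX,πY)` are bijective. -/
def IsCoveringFunctor (F : T ⥤ U) [F.Additive] : Prop :=
  (∀ X Y : T, Function.Bijective (coveringMapRight F X Y)) ∧
  (∀ X Y : T, Function.Bijective (coveringMapLeft F X Y))

end Covering

section Weights

variable {C : Type*} [Category C] [Preadditive C]

variable [HasShift C ℤ]

/-- The objects `Y` with `Hom(b[j], Y) = 0` for `b ∈ B` and `j < n`. -/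
def weightGE (B : Set C) (n : ℤ) : Set C :=
  {Y | ∀ b ∈ B, ∀ j : ℤ, j < n → ∀ f : b⟦j⟧ ⟶ Y, f = 0}

/-- The left orthogonal of `weightGE B (n + 1)`. -/
def weightLE (B : Set C) (n : ℤ) : Set C :=
  {Y | ∀ Q ∈ weightGE B (n + 1), ∀ f : Y ⟶ Q, f = 0}

variable {B : Set C}

lemma weightGE_antitone {m n : ℤ} (h : m ≤ n) : weightGE B n ⊆ weightGE B m :=
  fun _ hY b hb j hj f => hY b hb j (by lia) f

lemma weightLE_monotone {m n : ℤ} (h : m ≤ n) : weightLE B m ⊆ weightLE B n :=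
  fun _ hY Q hQ f => hY Q (weightGE_antitone (by lia) hQ) f

lemma weightGE_of_retract {n : ℤ} {X Y : C} (i : X ⟶ Y) (r : Y ⟶ X) (hir : i ≫ r = 𝟙 X)
    (hY : Y ∈ weightGE B n) : X ∈ weightGE B n := fun b hb j hj f => by
  rw [← Category.comp_id f, ← hir, ← Category.assoc, hY b hb j hj (f ≫ i), zero_comp]

lemma weightLE_of_retract {n : ℤ} {X Y : C} (i : X ⟶ Y) (r : Y ⟶ X) (hir : i ≫ r = 𝟙 X)
    (hY : Y ∈ weightLE B n) : X ∈ weightLE B n := fun Q hQ f => by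
  rw [← Category.id_comp f, ← hir, Category.assoc, hY Q hQ (r ≫ f), comp_zero]

lemma weightGE_of_isZero {n : ℤ} {X : C} (hX : IsZero X) : X ∈ weightGE B n :=
  fun _ _ _ _ _ => hX.eq_of_tgt _ _

lemma weightLE_of_isZero {n : ℤ} {X : C} (hX : IsZero X) : X ∈ weightLE B n :=
  fun _ _ _ => hX.eq_of_src _ _

lemma subset_weightLE : B ⊆ weightLE B 0 := fun b hb Q hQ f => by
  have h : ((shiftFunctorZero C ℤ).app b).hom ≫ f = 0 := hQ b hb 0 (by lia) _
  rw [← cancel_epi ((shiftFunctorZero C ℤ).app b).hom, h, comp_zero]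

variable [∀ n : ℤ, (shiftFunctor C n).Additive]

/-- Transport along shifts of the vanishing of all morphisms. -/
lemma hom_shift_eq_zero {A Y : C} {j k : ℤ}
    (h : ∀ f : A⟦j - k⟧ ⟶ Y, f = 0) (f : A⟦j⟧ ⟶ Y⟦k⟧) : f = 0 := by
  let e : (A⟦j - k⟧)⟦k⟧ ≅ A⟦j⟧ := (shiftFunctorAdd' C (j - k) k j (by lia)).symm.app A
  obtain ⟨g, hg⟩ := (shiftFunctor C k).map_surjective (e.hom ≫ f)
  rw [h g, Functor.map_zero] at hg
  rw [← cancel_epi e.hom, ← hg, comp_zero]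

lemma weightGE_shift {n : ℤ} {Y : C} (hY : Y ∈ weightGE B n) (k m : ℤ) (h : n + k = m) :
    Y⟦k⟧ ∈ weightGE B m :=
  fun b hb j hj f => hom_shift_eq_zero (fun g => hY b hb (j - k) (by lia) g) f

lemma weightLE_shift {n : ℤ} {Y : C} (hY : Y ∈ weightLE B n) (k m : ℤ) (h : n + k = m) :
    Y⟦k⟧ ∈ weightLE B m := fun Q hQ f => by
  let e : (Q⟦-k⟧)⟦k⟧ ≅ Q := (shiftFunctorCompIsoId C (-k) k (by lia)).app Q
  obtain ⟨g, hg⟩ := (shiftFunctor C k).map_surjective (f ≫ e.inv)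
  rw [hY _ (weightGE_shift hQ (-k) (n + 1) (by lia)) g, Functor.map_zero] at hg
  rw [← cancel_mono e.inv, ← hg, zero_comp]

lemma IsPresiltingSet.subset_weightGE (hB : IsPresiltingSet C B) : B ⊆ weightGE B 0 :=
  fun b hb b' hb' j hj f => by
    obtain ⟨g, rfl⟩ : ∃ g : (b'⟦j⟧ : C) ⟶ b⟦-j⟧⟦j⟧,
        f = g ≫ ((shiftFunctorCompIsoId C (-j) j (by lia)).app b).hom :=
      ⟨f ≫ ((shiftFunctorCompIsoId C (-j) j (by lia)).app b).inv, by simp⟩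
    obtain ⟨g, rfl⟩ := (shiftFunctor C j).map_surjective g
    rw [hB b' hb' b hb (-j) (by lia) g, Functor.map_zero, zero_comp]

variable [HasZeroObject C] [Pretriangulated C]

/-- Exactness of `Hom(A, -)` at the shift of the second object of a distinguished triangle. -/
lemma coyoneda_exact_shift (T : Triangle C) (hT : T ∈ distTriang C) {A : C}
    (x : A ⟶ T.obj₂⟦(1 : ℤ)⟧) (hx : x ≫ T.mor₂⟦(1 : ℤ)⟧' = 0) :
    ∃ y : A ⟶ T.obj₁⟦(1 : ℤ)⟧, x = y ≫ T.mor₁⟦(1 : ℤ)⟧' := by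
  obtain ⟨y, hy⟩ : ∃ y : A ⟶ T.obj₁⟦(1 : ℤ)⟧, x = y ≫ (-T.mor₁⟦(1 : ℤ)⟧') :=
    Triangle.coyoneda_exact₁ _ (rot_of_distTriang _ hT) x hx
  exact ⟨-y, by rw [hy, Preadditive.comp_neg, Preadditive.neg_comp]⟩

/-- A morphism from the first object of a distinguished triangle extends to the second object
when its composite with the connecting morphism vanishes. -/
lemma exists_extension (T : Triangle C) (hT : T ∈ distTriang C) {A : C} (x : T.obj₁ ⟶ A)
    (hx : T.mor₃ ≫ x⟦(1 : ℤ)⟧' = 0) : ∃ y : T.obj₂ ⟶ A, x = T.mor₁ ≫ y := by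
  obtain ⟨y, hy⟩ : ∃ y : T.obj₂⟦(1 : ℤ)⟧ ⟶ A⟦(1 : ℤ)⟧, x⟦(1 : ℤ)⟧' = (-T.mor₁⟦(1 : ℤ)⟧') ≫ y :=
    Triangle.yoneda_exact₂ _ (rot_of_distTriang _ (rot_of_distTriang _ hT)) _ hx
  obtain ⟨y, rfl⟩ := (shiftFunctor C (1 : ℤ)).map_surjective y
  refine ⟨-y, (shiftFunctor C (1 : ℤ)).map_injective ?_⟩
  rw [hy, Preadditive.comp_neg, Functor.map_neg, Functor.map_comp, Preadditive.neg_comp]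

/-- The objects that are iterated finite direct sums of objects of `S`. -/
inductive IsFiniteSum (S : Set C) : C → Prop
  | zero : IsFiniteSum S 0
  | of (X : C) (hX : X ∈ S) : IsFiniteSum S X
  | biprod (X Y : C) (hX : IsFiniteSum S X) (hY : IsFiniteSum S Y) : IsFiniteSum S (X ⊞ Y)

lemma IsFiniteSum.mem {S P : Set C} (h₀ : (0 : C) ∈ P)
    (hext : ∀ T : Triangle C, (T ∈ distTriang C) → T.obj₁ ∈ P → T.obj₃ ∈ P → T.obj₂ ∈ P)
    (hS : S ⊆ P) {X : C} (hX : IsFiniteSum S X) : X ∈ P := by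
  induction hX with
  | zero => exact h₀
  | of X hX => exact hS hX
  | biprod X Y _ _ ihX ihY => exact hext _ (binaryBiproductTriangle_distinguished X Y) ihX ihY

lemma weightGE_ext {n : ℤ} (T : Triangle C) (hT : T ∈ distTriang C)
    (h₁ : T.obj₁ ∈ weightGE B n) (h₃ : T.obj₃ ∈ weightGE B n) : T.obj₂ ∈ weightGE B n :=
  fun b hb j hj f => by
    obtain ⟨g, rfl⟩ := T.coyoneda_exact₂ hT f (h₃ b hb j hj _)
    rw [h₁ b hb j hj g, zero_comp]

lemma weightLE_ext {n : ℤ} (T : Triangle C) (hT : T ∈ distTriang C)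
    (h₁ : T.obj₁ ∈ weightLE B n) (h₃ : T.obj₃ ∈ weightLE B n) : T.obj₂ ∈ weightLE B n :=
  fun Q hQ f => by
    obtain ⟨g, rfl⟩ := T.yoneda_exact₂ hT f (h₁ Q hQ _)
    rw [h₃ Q hQ g, comp_zero]

lemma isThickSet_weightGE : IsThickSet C {Y | ∃ n, Y ∈ weightGE B n} := by
  refine ⟨fun X Y e ⟨n, h⟩ => ⟨n, weightGE_of_retract e.inv e.hom (by simp) h⟩,
    ⟨0, weightGE_of_isZero (isZero_zero C)⟩, fun X k ⟨n, h⟩ => ⟨_, weightGE_shift h k _ rfl⟩,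
    fun T hT ⟨n, h₁⟩ ⟨m, h₃⟩ => ⟨min n m, weightGE_ext T hT
      (weightGE_antitone (min_le_left _ _) h₁) (weightGE_antitone (min_le_right _ _) h₃)⟩,
    fun X Y ⟨i, r, hir⟩ ⟨n, h⟩ => ⟨n, weightGE_of_retract i r hir h⟩⟩

lemma isThickSet_weightLE : IsThickSet C {Y | ∃ n, Y ∈ weightLE B n} := by
  refine ⟨fun X Y e ⟨n, h⟩ => ⟨n, weightLE_of_retract e.inv e.hom (by simp) h⟩,
    ⟨0, weightLE_of_isZero (isZero_zero C)⟩, fun X k ⟨n, h⟩ => ⟨_, weightLE_shift h k _ rfl⟩,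
    fun T hT ⟨n, h₁⟩ ⟨m, h₃⟩ => ⟨max n m, weightLE_ext T hT
      (weightLE_monotone (le_max_left _ _) h₁) (weightLE_monotone (le_max_right _ _) h₃)⟩,
    fun X Y ⟨i, r, hir⟩ ⟨n, h⟩ => ⟨n, weightLE_of_retract i r hir h⟩⟩

/-- The objects `W` of weight at most `0` with a morphism to a finite direct sum of objects
of `B` through which every morphism from `W` to an object of `weightGE B 0` factors. -/
def weightLEFinite (B : Set C) : Set C :=
  {W | W ∈ weightLE B 0 ∧ ∃ (c : C) (_ : IsFiniteSum B c) (p : W ⟶ c),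
    ∀ Q ∈ weightGE B 0, ∀ f : W ⟶ Q, ∃ g, f = p ≫ g}

lemma weightLEFinite_of_weightLE {W : C} (hW : W ∈ weightLE B (-1)) : W ∈ weightLEFinite B :=
  ⟨weightLE_monotone (by lia) hW, 0, .zero, 0, fun Q hQ f => ⟨0, by
    rw [hW Q (weightGE_antitone (by lia) hQ) f, zero_comp]⟩⟩

lemma weightLEFinite_of_iso {X Y : C} (e : X ≅ Y) (hX : X ∈ weightLEFinite B) :
    Y ∈ weightLEFinite B := by
  obtain ⟨hX, c, hc, p, hp⟩ := hX
  refine ⟨weightLE_of_retract e.inv e.hom (by simp) hX, c, hc, e.inv ≫ p, fun Q hQ f => ?_⟩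
  obtain ⟨g, hg⟩ := hp Q hQ (e.hom ≫ f)
  exact ⟨g, by rw [Category.assoc, ← hg, Iso.inv_hom_id_assoc]⟩

lemma weightLEFinite_ext (hB : IsPresiltingSet C B) (T : Triangle C) (hT : T ∈ distTriang C)
    (h₁ : T.obj₁ ∈ weightLEFinite B) (h₃ : T.obj₃ ∈ weightLEFinite B) :
    T.obj₂ ∈ weightLEFinite B := by
  obtain ⟨h₁, c₁, hc₁, p₁, hp₁⟩ := h₁
  obtain ⟨h₃, c₃, hc₃, p₃, hp₃⟩ := h₃
  have hc₁' : c₁ ∈ weightGE B 0 :=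
    hc₁.mem (weightGE_of_isZero (isZero_zero C)) weightGE_ext hB.subset_weightGE
  obtain ⟨q, hq⟩ := exists_extension T hT p₁ (h₃ _ (weightGE_shift hc₁' 1 _ (by lia)) _)
  refine ⟨weightLE_ext T hT h₁ h₃, c₁ ⊞ c₃, .biprod _ _ hc₁ hc₃, biprod.lift q (T.mor₂ ≫ p₃),
    fun Q hQ f => ?_⟩
  obtain ⟨g₁, hg₁⟩ := hp₁ Q hQ (T.mor₁ ≫ f)
  obtain ⟨k, hk⟩ := T.yoneda_exact₂ hT (f - q ≫ g₁) (by
    rw [Preadditive.comp_sub, hg₁, hq, Category.assoc, sub_self])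
  obtain ⟨g₃, rfl⟩ := hp₃ Q hQ k
  refine ⟨biprod.desc g₁ g₃, ?_⟩
  rw [biprod.lift_desc, Category.assoc, ← hk]
  abel

/-- A weight decomposition of `Y` whose part of weight at most `0` lies in
`weightLEFinite B`. -/
def HasWeightDecomposition (B : Set C) (Y : C) : Prop :=
  ∃ (W Z : C) (f : W ⟶ Y) (g : Y ⟶ Z) (h : Z ⟶ W⟦(1 : ℤ)⟧),
    (Triangle.mk f g h ∈ distTriang C) ∧ W ∈ weightLEFinite B ∧ Z ∈ weightGE B 1

lemma HasWeightDecomposition.of_iso {X Y : C} (e : X ≅ Y) (hX : HasWeightDecomposition B X) :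
    HasWeightDecomposition B Y := by
  obtain ⟨W, Z, f, g, h, hT, hW, hZ⟩ := hX
  refine ⟨W, Z, f ≫ e.hom, e.inv ≫ g, h, isomorphic_distinguished _ hT _ ?_, hW, hZ⟩
  refine Triangle.isoMk _ _ (Iso.refl W) e.symm (Iso.refl Z) ?_ ?_ ?_
  · change (f ≫ e.hom) ≫ e.inv = 𝟙 W ≫ f
    simp
  · change (e.inv ≫ g) ≫ 𝟙 Z = e.inv ≫ g
    simp
  · change h ≫ (shiftFunctor C (1 : ℤ)).map (𝟙 W) = 𝟙 Z ≫ h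
    simp

lemma HasWeightDecomposition.of_weightGE {X : C} (hX : X ∈ weightGE B 1) :
    HasWeightDecomposition B X :=
  ⟨0, X, _, _, _, contractible_distinguished₁ X,
    weightLEFinite_of_weightLE (weightLE_of_isZero (isZero_zero C)), hX⟩

lemma HasWeightDecomposition.of_weightLEFinite {X : C} (hX : X ∈ weightLEFinite B) :
    HasWeightDecomposition B X :=
  ⟨X, 0, _, _, _, contractible_distinguished X, hX, weightGE_of_isZero (isZero_zero C)⟩

lemma HasWeightDecomposition.ext (hB : IsPresiltingSet C B) (T : Triangle C)
    (hT : T ∈ distTriang C) (h₁ : HasWeightDecomposition B T.obj₁)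
    (h₃ : HasWeightDecomposition B T.obj₃) : HasWeightDecomposition B T.obj₂ := by
  obtain ⟨W₁, Z₁, f₁, g₁, k₁, hT₁, hW₁, hZ₁⟩ := h₁
  obtain ⟨W₃, Z₃, f₃, g₃, k₃, hT₃, hW₃, hZ₃⟩ := h₃
  obtain ⟨k, hk⟩ : ∃ k : W₃ ⟶ W₁⟦(1 : ℤ)⟧, f₃ ≫ T.mor₃ = k ≫ f₁⟦(1 : ℤ)⟧' :=
    coyoneda_exact_shift _ hT₁ (f₃ ≫ T.mor₃)
      (hW₃.1 _ (weightGE_antitone (by lia) (weightGE_shift hZ₁ 1 _ rfl)) _)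
  obtain ⟨W₂, u, v, hW⟩ := distinguished_cocone_triangle₂ k
  obtain ⟨f₂, hu, hv⟩ : ∃ f₂ : W₂ ⟶ T.obj₂, u ≫ f₂ = f₁ ≫ T.mor₁ ∧ v ≫ f₃ = f₂ ≫ T.mor₂ :=
    complete_distinguished_triangle_morphism₂ _ _ hW hT f₁ f₃ hk.symm
  obtain ⟨Z₂, g₂, k₂, hT₂⟩ := distinguished_cocone_triangle f₂
  refine ⟨W₂, Z₂, f₂, g₂, k₂, hT₂, weightLEFinite_ext hB _ hW hW₁ hW₃, fun b hb j hj x => ?_⟩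
  have epi₁ : ∀ y : b⟦j⟧ ⟶ T.obj₁, ∃ z, y = z ≫ f₁ := fun y =>
    Triangle.coyoneda_exact₂ _ hT₁ y (hZ₁ b hb j hj _)
  have epi₃ : ∀ y : b⟦j⟧ ⟶ T.obj₃, ∃ z, y = z ≫ f₃ := fun y =>
    Triangle.coyoneda_exact₂ _ hT₃ y (hZ₃ b hb j hj _)
  have mono₁ : ∀ y : b⟦j⟧ ⟶ W₁⟦(1 : ℤ)⟧, y ≫ f₁⟦(1 : ℤ)⟧' = 0 → y = 0 := fun y hy => by
    obtain ⟨z, rfl⟩ : ∃ z : b⟦j⟧ ⟶ Z₁, y = z ≫ k₁ := Triangle.coyoneda_exact₁ _ hT₁ y hy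
    rw [hZ₁ b hb j hj z, zero_comp]
  have mono₃ : ∀ y : b⟦j⟧ ⟶ W₃⟦(1 : ℤ)⟧, y ≫ f₃⟦(1 : ℤ)⟧' = 0 → y = 0 := fun y hy => by
    obtain ⟨z, rfl⟩ : ∃ z : b⟦j⟧ ⟶ Z₃, y = z ≫ k₃ := Triangle.coyoneda_exact₁ _ hT₃ y hy
    rw [hZ₃ b hb j hj z, zero_comp]
  have hkf : k ≫ u⟦(1 : ℤ)⟧' = 0 := comp_distTriang_mor_zero₃₁ _ hW
  have hvk : v ≫ k = 0 := comp_distTriang_mor_zero₂₃ _ hW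
  have hfg : f₂ ≫ g₂ = 0 := comp_distTriang_mor_zero₁₂ _ hT₂
  have hkk : k₂ ≫ f₂⟦(1 : ℤ)⟧' = 0 := comp_distTriang_mor_zero₃₁ _ hT₂
  have mono₂ : ∀ y : b⟦j⟧ ⟶ W₂⟦(1 : ℤ)⟧, y ≫ f₂⟦(1 : ℤ)⟧' = 0 → y = 0 := fun y hy => by
    obtain ⟨z, rfl⟩ : ∃ z : b⟦j⟧ ⟶ W₁⟦(1 : ℤ)⟧, y = z ≫ u⟦(1 : ℤ)⟧' :=
      coyoneda_exact_shift _ hW y (mono₃ (y ≫ v⟦(1 : ℤ)⟧') (by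
        rw [Category.assoc, ← Functor.map_comp, hv, Functor.map_comp, reassoc_of% hy, zero_comp]))
    rw [Category.assoc, ← Functor.map_comp, hu, Functor.map_comp, ← Category.assoc] at hy
    obtain ⟨w, hw⟩ := T.coyoneda_exact₁ hT _ hy
    obtain ⟨w', rfl⟩ := epi₃ w
    have hz : z - w' ≫ k = 0 := mono₁ _ (by
      rw [Preadditive.sub_comp, hw, Category.assoc, Category.assoc, hk, sub_self])
    rw [sub_eq_zero.1 hz, Category.assoc, hkf, comp_zero]
  have epi₂ : ∀ y : b⟦j⟧ ⟶ T.obj₂, ∃ z, y = z ≫ f₂ := fun y => by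
    obtain ⟨w, hw⟩ := epi₃ (y ≫ T.mor₂)
    obtain ⟨w', hw'⟩ : ∃ w' : b⟦j⟧ ⟶ W₂, w = w' ≫ v :=
      Triangle.coyoneda_exact₃ _ hW w (mono₁ (w ≫ k) (by
        rw [Category.assoc, ← hk, ← reassoc_of% hw, comp_distTriang_mor_zero₂₃ _ hT, comp_zero]))
    obtain ⟨s, hs⟩ := T.coyoneda_exact₂ hT (y - w' ≫ f₂) (by
      rw [Preadditive.sub_comp, hw, hw', Category.assoc, Category.assoc, hv, sub_self])
    obtain ⟨s', rfl⟩ := epi₁ s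
    refine ⟨s' ≫ u + w', ?_⟩
    rw [Preadditive.add_comp, Category.assoc, hu, ← Category.assoc, ← hs, sub_add_cancel]
  obtain ⟨y, rfl⟩ : ∃ y, x = y ≫ g₂ := Triangle.coyoneda_exact₃ _ hT₂ x (mono₂ (x ≫ k₂) (by
    rw [Category.assoc, hkk, comp_zero]))
  obtain ⟨z, rfl⟩ := epi₂ y
  rw [Category.assoc, hfg, comp_zero]

/-- The objects all of whose shifts have weight decompositions. -/
def weightDecomposable (B : Set C) : Set C :=
  {Y | ∀ k : ℤ, HasWeightDecomposition B (Y⟦k⟧)}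

lemma weightDecomposable_shift {Y : C} (hY : Y ∈ weightDecomposable B) (n : ℤ) :
    Y⟦n⟧ ∈ weightDecomposable B :=
  fun k => (hY (n + k)).of_iso ((shiftFunctorAdd C n k).app Y)

lemma weightDecomposable_ext (hB : IsPresiltingSet C B) (T : Triangle C)
    (hT : T ∈ distTriang C) (h₁ : T.obj₁ ∈ weightDecomposable B)
    (h₃ : T.obj₃ ∈ weightDecomposable B) : T.obj₂ ∈ weightDecomposable B :=
  fun k => HasWeightDecomposition.ext hB _ (T.shift_distinguished hT k) (h₁ k) (h₃ k)

lemma subset_weightDecomposable (hB : IsPresiltingSet C B) : B ⊆ weightDecomposable B := by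
  intro b hb k
  rcases lt_trichotomy k 0 with hk | rfl | hk
  · exact .of_weightLEFinite (weightLEFinite_of_weightLE
      (weightLE_monotone (by lia) (weightLE_shift (subset_weightLE hb) k _ rfl)))
  · have hb' : b ∈ weightLEFinite B :=
      ⟨subset_weightLE hb, b, .of b hb, 𝟙 b, fun _ _ f => ⟨f, by simp⟩⟩
    exact .of_weightLEFinite (weightLEFinite_of_iso ((shiftFunctorZero C ℤ).symm.app b) hb')
  · exact .of_weightGE (weightGE_antitone (by lia)
      (weightGE_shift (hB.subset_weightGE hb) k _ rfl))

lemma isThickSet_retracts {K : Set C} (h₀ : (0 : C) ∈ K)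
    (hshift : ∀ (X : C) (n : ℤ), X ∈ K → (X⟦n⟧ : C) ∈ K)
    (hext : ∀ T : Triangle C, (T ∈ distTriang C) → T.obj₁ ∈ K → T.obj₃ ∈ K → T.obj₂ ∈ K) :
    IsThickSet C {X | ∃ Y ∈ K, ∃ (i : X ⟶ Y) (r : Y ⟶ X), i ≫ r = 𝟙 X} := by
  have hretract : ∀ (X Y : C), (∃ (i : X ⟶ Y) (r : Y ⟶ X), i ≫ r = 𝟙 X) →
      (∃ Z ∈ K, ∃ (i : Y ⟶ Z) (r : Z ⟶ Y), i ≫ r = 𝟙 Y) →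
      ∃ Z ∈ K, ∃ (i : X ⟶ Z) (r : Z ⟶ X), i ≫ r = 𝟙 X := by
    rintro X Y ⟨i, r, hir⟩ ⟨Z, hZ, i', r', hir'⟩
    exact ⟨Z, hZ, i ≫ i', r' ≫ r, by simp [reassoc_of% hir', hir]⟩
  refine ⟨fun X Y e hX => hretract _ _ ⟨e.inv, e.hom, by simp⟩ hX,
    ⟨0, h₀, 𝟙 _, 𝟙 _, by simp⟩, ?_, ?_, hretract⟩
  · rintro X n ⟨Y, hY, i, r, hir⟩
    exact ⟨Y⟦n⟧, hshift Y n hY, i⟦n⟧', r⟦n⟧', by rw [← Functor.map_comp, hir, CategoryTheory.Functor.map_id]⟩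
  · rintro T hT ⟨Y₁, hY₁, i₁, r₁, h₁⟩ ⟨Y₃, hY₃, i₃, r₃, h₃⟩
    obtain ⟨Y₂, u, v, hY⟩ := distinguished_cocone_triangle₂ (r₃ ≫ T.mor₃ ≫ i₁⟦(1 : ℤ)⟧')
    obtain ⟨i₂, hi, hi'⟩ : ∃ i₂ : T.obj₂ ⟶ Y₂,
        T.mor₁ ≫ i₂ = i₁ ≫ u ∧ T.mor₂ ≫ i₃ = i₂ ≫ v := by
      refine complete_distinguished_triangle_morphism₂ _ _ hT hY i₁ i₃ ?_
      change T.mor₃ ≫ i₁⟦(1 : ℤ)⟧' = i₃ ≫ r₃ ≫ T.mor₃ ≫ i₁⟦(1 : ℤ)⟧'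
      rw [reassoc_of% h₃]
    obtain ⟨r₂, hr, hr'⟩ : ∃ r₂ : Y₂ ⟶ T.obj₂,
        u ≫ r₂ = r₁ ≫ T.mor₁ ∧ v ≫ r₃ = r₂ ≫ T.mor₂ := by
      refine complete_distinguished_triangle_morphism₂ _ _ hY hT r₁ r₃ ?_
      change (r₃ ≫ T.mor₃ ≫ i₁⟦(1 : ℤ)⟧') ≫ r₁⟦(1 : ℤ)⟧' = r₃ ≫ T.mor₃
      rw [Category.assoc, Category.assoc, ← Functor.map_comp, h₁,
        CategoryTheory.Functor.map_id, Category.comp_id]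
    let φ : T ⟶ T :=
      { hom₁ := 𝟙 _
        hom₂ := i₂ ≫ r₂
        hom₃ := 𝟙 _
        comm₁ := by rw [reassoc_of% hi, hr, reassoc_of% h₁, Category.id_comp]
        comm₂ := by rw [Category.assoc, ← hr', ← reassoc_of% hi', h₃]
        comm₃ := by simp }
    have : IsIso (i₂ ≫ r₂) := isIso₂_of_isIso₁₃ φ hT hT
      (inferInstanceAs (IsIso (𝟙 _))) (inferInstanceAs (IsIso (𝟙 _)))
    exact ⟨Y₂, hext _ hY hY₁ hY₃, i₂, r₂ ≫ inv (i₂ ≫ r₂), by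
      rw [← Category.assoc, IsIso.hom_inv_id]⟩

/-- If the presilting set `B` generates, every object of `weightGE B 0` has a right
approximation by a finite direct sum of objects of `B`. -/
lemma exists_right_approximation (hB : IsPresiltingSet C B) (hgen : GeneratesTriang C B)
    {Y : C} (hY : Y ∈ weightGE B 0) :
    ∃ (c : C) (_ : IsFiniteSum B c) (p : c ⟶ Y), ∀ b ∈ B, ∀ f : b ⟶ Y, ∃ g, f = g ≫ p := by
  have hzero : (0 : C) ∈ weightDecomposable B := fun k =>
    .of_weightGE (weightGE_shift (weightGE_of_isZero (n := 1 - k) (isZero_zero C)) k 1 (by lia))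
  obtain ⟨Y₁, hY₁, i, r, hir⟩ := hgen _ (isThickSet_retracts hzero
    (fun X n hX => weightDecomposable_shift hX n) (weightDecomposable_ext hB))
    (fun b hb => ⟨b, subset_weightDecomposable hB hb, 𝟙 b, 𝟙 b, by simp⟩) Y
  obtain ⟨D, u, v, hD⟩ := distinguished_cocone_triangle (𝟙 Y₁ - r ≫ i)
  have hu : (𝟙 Y₁ - r ≫ i) ≫ u = 0 := comp_distTriang_mor_zero₁₂ _ hD
  have hDK : D ∈ weightDecomposable B := weightDecomposable_ext hB _ (rot_of_distTriang _ hD)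
    hY₁ (weightDecomposable_shift hY₁ 1)
  have hDGE : D ∈ weightGE B 0 := fun b hb j hj x => by
    have hv : v ≫ (𝟙 Y₁ - r ≫ i)⟦(1 : ℤ)⟧' = 0 := comp_distTriang_mor_zero₃₁ _ hD
    have hxv : x ≫ v = 0 := by
      have h0 : (x ≫ v) ≫ r⟦(1 : ℤ)⟧' = 0 := weightGE_shift hY 1 1 (by lia) b hb j (by lia) _
      rw [Functor.map_sub, CategoryTheory.Functor.map_id, Preadditive.comp_sub, Category.comp_id, sub_eq_zero,
        Functor.map_comp] at hv
      rw [hv, ← Category.assoc, ← Category.assoc, h0, zero_comp]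
    obtain ⟨z, rfl⟩ : ∃ z, x = z ≫ u := Triangle.coyoneda_exact₃ _ hD x hxv
    rw [Preadditive.sub_comp, Category.id_comp, sub_eq_zero, Category.assoc] at hu
    rw [hu, ← Category.assoc, hY b hb j hj (z ≫ r), zero_comp]
  obtain ⟨s, hs⟩ : ∃ s : D ⟶ Y, r = u ≫ s := by
    refine Triangle.yoneda_exact₂ _ hD r ?_
    change (𝟙 Y₁ - r ≫ i) ≫ r = 0
    rw [Preadditive.sub_comp, Category.assoc, hir, Category.id_comp, Category.comp_id, sub_self]
  obtain ⟨W, Z, f, g, h, hT, hW, hZ⟩ := (hDK 0).of_iso ((shiftFunctorZero C ℤ).app D)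
  have hWGE : W ∈ weightGE B 0 := weightGE_ext _ (inv_rot_of_distTriang _ hT)
    (weightGE_shift hZ (-1) 0 (by lia)) hDGE
  obtain ⟨-, c, hc, p, hp⟩ := hW
  obtain ⟨q, hq⟩ := hp W hWGE (𝟙 W)
  refine ⟨c, hc, q ≫ f ≫ s, fun b hb x => ?_⟩
  obtain ⟨y, hy⟩ : ∃ y, x ≫ i ≫ u = y ≫ f := Triangle.coyoneda_exact₂ _ hT (x ≫ i ≫ u) (by
    rw [← cancel_epi ((shiftFunctorZero C ℤ).app b).hom, comp_zero]
    exact hZ b hb 0 (by lia) _)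
  refine ⟨y ≫ p, ?_⟩
  rw [Category.assoc, ← reassoc_of% hq, ← reassoc_of% hy, ← hs, hir, Category.comp_id]

end Weights

section Covering

variable {T : Type*} [Category T] [Preadditive T] {U : Type*} [Category U] [Preadditive U]
  {F : T ⥤ U}

lemma IsCoveringFunctor.map_eq_zero [F.Additive] (hF : IsCoveringFunctor F) {X Y : T} (f : X ⟶ Y)
    (hf : F.map f = 0) : f = 0 := by
  classical
  apply DirectSum.of_injective
    (β := fun Y' : {Y' : T // F.obj Y' = F.obj Y} => (X ⟶ (Y' : T))) ⟨Y, rfl⟩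
  apply (hF.1 X Y).1
  simp [coveringMapRight, hf]

variable [HasZeroObject T] [HasShift T ℤ] [∀ n : ℤ, (shiftFunctor T n).Additive]
  [Pretriangulated T] [HasZeroObject U] [HasShift U ℤ] [∀ n : ℤ, (shiftFunctor U n).Additive]
  [Pretriangulated U]

/-- A morphism to `F Y` from a finite direct sum of objects of `B` factors through the image
of a morphism to `Y` from a finite direct sum of objects of the preimage of `B`. -/
lemma IsCoveringFunctor.exists_factorization [F.Additive] (hF : IsCoveringFunctor F) {B : Set U}
    (hB : ∀ b ∈ B, ∃ X : T, F.obj X = b) {Y : T} {c : U} (hc : IsFiniteSum B c)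
    (φ : c ⟶ F.obj Y) :
    ∃ (X : T) (_ : IsFiniteSum (F.obj ⁻¹' B) X) (f : X ⟶ Y) (g : c ⟶ F.obj X),
      φ = g ≫ F.map f := by
  classical
  induction hc with
  | zero => exact ⟨0, .zero, 0, 0, (isZero_zero U).eq_of_src _ _⟩
  | of b hb =>
    obtain ⟨X, rfl⟩ := hB b hb
    obtain ⟨s, rfl⟩ := (hF.2 X Y).2 φ
    induction s using DirectSum.induction_on with
    | zero => exact ⟨0, .zero, 0, 0, by simp⟩
    | of X' f =>
      refine ⟨X', .of _ ?_, f, eqToHom X'.2.symm, by simp [coveringMapLeft]⟩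
      rw [Set.mem_preimage, X'.2]
      exact hb
    | add s t hs ht =>
      obtain ⟨X₁, hX₁, f₁, g₁, h₁⟩ := hs
      obtain ⟨X₂, hX₂, f₂, g₂, h₂⟩ := ht
      refine ⟨X₁ ⊞ X₂, .biprod _ _ hX₁ hX₂, biprod.desc f₁ f₂,
        g₁ ≫ F.map biprod.inl + g₂ ≫ F.map biprod.inr, ?_⟩
      rw [map_add, h₁, h₂, Preadditive.add_comp, Category.assoc, Category.assoc,
        ← F.map_comp, ← F.map_comp, biprod.inl_desc, biprod.inr_desc]
  | biprod c₁ c₂ _ _ ih₁ ih₂ =>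
    obtain ⟨X₁, hX₁, f₁, g₁, h₁⟩ := ih₁ (biprod.inl ≫ φ)
    obtain ⟨X₂, hX₂, f₂, g₂, h₂⟩ := ih₂ (biprod.inr ≫ φ)
    refine ⟨X₁ ⊞ X₂, .biprod _ _ hX₁ hX₂, biprod.desc f₁ f₂,
      biprod.desc (g₁ ≫ F.map biprod.inl) (g₂ ≫ F.map biprod.inr), ?_⟩
    ext
    · rw [h₁, biprod.inl_desc_assoc, Category.assoc, ← F.map_comp, biprod.inl_desc]
    · rw [h₂, biprod.inr_desc_assoc, Category.assoc, ← F.map_comp, biprod.inr_desc]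

variable [F.CommShift ℤ] [F.IsTriangulated]

lemma GeneratesTriang.of_preimage (hgen : GeneratesTriang U (Set.range F.obj)) {B : Set U}
    (hB : GeneratesTriang T (F.obj ⁻¹' B)) : GeneratesTriang U B := by
  intro P hP hBP
  refine hgen P hP ?_
  obtain ⟨hiso, hzero, hshift, hext, hretract⟩ := hP
  rintro _ ⟨X, rfl⟩
  refine hB (F.obj ⁻¹' P) ⟨fun X Y e hX => hiso (F.mapIso e) hX,
    hiso F.mapZeroObject.symm hzero,
    fun X n hX => hiso ((F.commShiftIso n).app X).symm (hshift _ n hX),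
    fun D hD h₁ h₃ => hext _ (F.map_distinguished D hD) h₁ h₃,
    fun X Y ⟨i, r, hir⟩ hY => hretract _ _ ⟨F.map i, F.map r, by
      rw [← F.map_comp, hir, F.map_id]⟩ hY⟩ (fun X hX => hBP hX) X

lemma IsCoveringFunctor.mem_of_weight [F.Additive] (hF : IsCoveringFunctor F) {B : Set U}
    (hB : ∀ b ∈ B, ∃ X : T, F.obj X = b) (hpre : IsPresiltingSet U B)
    (hgen : GeneratesTriang U B) {P : Set T} (hP : IsThickSet T P) (hBP : F.obj ⁻¹' B ⊆ P)
    (d : ℕ) (Y : T) (hGE : F.obj Y ∈ weightGE B 0) (hLE : F.obj Y ∈ weightLE B d) : Y ∈ P := by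
  obtain ⟨hiso, hzero, hshift, hext, hretract⟩ := hP
  have sum_mem {X : T} {Q : Set U} (hQ : ∀ Z : U, IsZero Z → Z ∈ Q)
      (hQext : ∀ D : Triangle U, (D ∈ distTriang U) → D.obj₁ ∈ Q → D.obj₃ ∈ Q → D.obj₂ ∈ Q)
      (hBQ : B ⊆ Q) (hX : IsFiniteSum (F.obj ⁻¹' B) X) : F.obj X ∈ Q :=
    hX.mem (P := F.obj ⁻¹' Q) (hQ _ (F.map_isZero (isZero_zero T)))
      (fun D hD h₁ h₃ => hQext _ (F.map_distinguished D hD) h₁ h₃) (fun _ h => hBQ h)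
  induction d using Nat.strong_induction_on generalizing Y with | _ d ih =>
  obtain ⟨c, hc, p, hp⟩ := exists_right_approximation hpre hgen hGE
  obtain ⟨X, hX, f, g, rfl⟩ := hF.exists_factorization hB hc p
  have hXP : X ∈ P := hX.mem hzero hext hBP
  have hXGE : F.obj X ∈ weightGE B 0 :=
    sum_mem (fun _ => weightGE_of_isZero) weightGE_ext hpre.subset_weightGE hX
  have hXLE : F.obj X ∈ weightLE B 0 :=
    sum_mem (fun _ => weightLE_of_isZero) weightLE_ext subset_weightLE hX
  obtain ⟨Y', u, v, hD⟩ := distinguished_cocone_triangle f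
  have hFD := F.map_distinguished _ hD
  have hY'GE : F.obj Y' ∈ weightGE B 1 := fun b hb j hj x => by
    obtain ⟨y, rfl⟩ : ∃ y, x = y ≫ F.map u := Triangle.coyoneda_exact₃ _ hFD x
      (weightGE_shift hXGE 1 1 (by lia) b hb j hj _)
    rcases lt_or_eq_of_le (show j ≤ 0 by lia) with hj' | rfl
    · rw [hGE b hb j hj' y, zero_comp]
    · obtain ⟨z, hz⟩ := hp b hb (((shiftFunctorZero U ℤ).app b).inv ≫ y)
      have hfu : F.map f ≫ F.map u = 0 := comp_distTriang_mor_zero₁₂ _ hFD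
      rw [← cancel_epi ((shiftFunctorZero U ℤ).app b).inv, ← Category.assoc, hz,
        Category.assoc, Category.assoc, hfu, comp_zero, comp_zero, comp_zero]
  rcases d with _ | d
  · have hu : u = 0 := hF.map_eq_zero u (hLE _ hY'GE _)
    obtain ⟨s, hs⟩ : ∃ s : Y ⟶ X, 𝟙 Y = s ≫ f :=
      Triangle.coyoneda_exact₂ _ hD (𝟙 Y) ((Category.id_comp u).trans hu)
    exact hretract Y X ⟨s, f, hs.symm⟩ hXP
  · have hY'LE : F.obj Y' ∈ weightLE B (d + 1) := weightLE_ext _ (rot_of_distTriang _ hFD)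
      (by exact_mod_cast hLE) (weightLE_monotone (by lia) (weightLE_shift hXLE 1 1 (by lia)))
    have e := (F.commShiftIso (-1 : ℤ)).app Y'
    have hmem : Y'⟦(-1 : ℤ)⟧ ∈ P := ih d (by lia) _
      (weightGE_of_retract e.hom e.inv (by simp) (weightGE_shift hY'GE (-1) 0 (by lia)))
      (weightLE_of_retract e.hom e.inv (by simp) (weightLE_shift hY'LE (-1) d (by lia)))
    exact hext _ hD hXP
      (hiso ((shiftFunctorCompIsoId T (-1 : ℤ) 1 (by lia)).app Y') (hshift _ 1 hmem))

end Covering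

/-!
STATEMENT 12: Let `π : T → U` be a covering functor between idempotent-complete
triangulated categories such that the image of `π` generates `U`, and let `B` be a
presilting full subcategory of `U` closed under direct summands and contained in
the image of `π`. Then `B` generates `U` if and only if `π⁻¹B` generates `T`.
-/

theorem generates_iff_preimage_generates
    {T : Type*} [Category T] [Preadditive T] [HasZeroObject T] [HasShift T ℤ]
    [∀ n : ℤ, (shiftFunctor T n).Additive] [Pretriangulated T]
    [IsIdempotentComplete T]
    {U : Type*} [Category U] [Preadditive U] [HasZeroObject U] [HasShift U ℤ]
    [∀ n : ℤ, (shiftFunctor U n).Additive] [Pretriangulated U]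
    [IsIdempotentComplete U]
    (F : T ⥤ U) [F.Additive] [F.CommShift ℤ] [F.IsTriangulated]
    (hcov : IsCoveringFunctor F)
    (hgen : GeneratesTriang U (Set.range F.obj))
    (B : Set U) (hB : ∀ Y ∈ B, ∃ X : T, F.obj X = Y)
    (hpre : IsPresiltingSet U B)
    (hsummand : ∀ X Y : U,
      (∃ (i : X ⟶ Y) (r : Y ⟶ X), i ≫ r = 𝟙 X) → Y ∈ B → X ∈ B) :
    GeneratesTriang U B ↔ GeneratesTriang T (F.obj ⁻¹' B) := by
  refine ⟨fun hBgen P hP hBP X => ?_, fun h => .of_preimage hgen h⟩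
  obtain ⟨n, hn⟩ := hBgen _ isThickSet_weightGE (fun b hb => ⟨0, hpre.subset_weightGE hb⟩)
    (F.obj X)
  obtain ⟨m, hm⟩ := hBgen _ isThickSet_weightLE (fun b hb => ⟨0, subset_weightLE hb⟩) (F.obj X)
  have e := (F.commShiftIso (-n)).app X
  have hX : X⟦-n⟧ ∈ P := hcov.mem_of_weight hB hpre hBgen hP hBP (m - n).toNat _
    (weightGE_of_retract e.hom e.inv (by simp) (weightGE_shift hn (-n) 0 (by lia)))
    (weightLE_of_retract e.hom e.inv (by simp)
      (weightLE_monotone (by lia) (weightLE_shift hm (-n) _ rfl)))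
  exact hP.1 ((shiftFunctorCompIsoId T (-n) n (by lia)).app X) (hP.2.2.1 _ n hX)
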